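/- For all k ∈ ℤ and m,n ∈ ℕ, in C one has: r^{k,m,n}·t_11* = r^{k,m,n}·t_22, r^{k,m,n}·t_12* = −q r^{k,m,n}·t_21, r^{k,m,n}·t_21* = −q^{-1} r^{k,m,n}·t_12, and r^{k,m,n}·t_22* = r^{k,m,n}·t_11. -/

import Mathlib

open scoped TensorProduct

noncomputable section

namespace QIB

/-- Generators of `A(U_q(4))`: the matrix entries `t i j` and the extra generator `D_q⁻¹`. -/
abbrev genU : Type := (Fin 4 × Fin 4) ⊕ Unit

abbrev FU : Type := FreeAlgebra ℂ genU

def T (i j : Fin 4) : FU := FreeAlgebra.ι ℂ (Sum.inl (i, j))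

def Dinv0 : FU := FreeAlgebra.ι ℂ (Sum.inr ())

/-- The length (number of inversions) of a permutation of `Fin 4`. -/
def plen (σ : Equiv.Perm (Fin 4)) : ℕ :=
  ((Finset.univ : Finset (Fin 4 × Fin 4)).filter fun p => p.1 < p.2 ∧ σ p.2 < σ p.1).card

/-- The quantum determinant, as an element of the free algebra. -/
def Dq0 (q : ℝ) : FU :=
  ∑ σ : Equiv.Perm (Fin 4),
    ((-(q : ℂ)) ^ plen σ) • (T (σ 0) 0 * T (σ 1) 1 * T (σ 2) 2 * T (σ 3) 3)

/-- The defining relations of `A(U_q(4))`. -/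
inductive relU (q : ℝ) : FU → FU → Prop
  | col {i j k : Fin 4} : i < j → relU q (T i k * T j k) ((q : ℂ) • (T j k * T i k))
  | row {i j k : Fin 4} : i < j → relU q (T k i * T k j) ((q : ℂ) • (T k j * T k i))
  | comm {i j k l : Fin 4} : i < j → k < l → relU q (T i l * T j k) (T j k * T i l)
  | qcom {i j k l : Fin 4} : i < j → k < l →
      relU q (T i k * T j l - T j l * T i k) (((q : ℂ) - (q : ℂ)⁻¹) • (T j k * T i l))
  | dr : relU q (Dq0 q * Dinv0) 1
  | dl : relU q (Dinv0 * Dq0 q) 1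

variable (q : ℝ)

/-- The algebra `A(U_q(4))`. -/
abbrev AU : Type := RingQuot (relU q)

/-- The generators `t i j` of `A(U_q(4))` (indices are 0-based). -/
def tt (i j : Fin 4) : AU q := RingQuot.mkAlgHom ℂ (relU q) (T i j)

/-- The generator `D_q⁻¹`. -/
def dI : AU q := RingQuot.mkAlgHom ℂ (relU q) Dinv0

/-- The quantum determinant `D_q` in `A(U_q(4))`. -/
def Dq : AU q := RingQuot.mkAlgHom ℂ (relU q) (Dq0 q)

/-- The spanning set `R` of relation elements (0-based indices). -/
def Rset : Set (AU q) :=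
  {tt q 0 2, tt q 2 0, tt q 0 3, tt q 3 0, tt q 1 3, tt q 3 1, tt q 1 2, tt q 2 1,
   tt q 0 0 - tt q 3 3, tt q 0 1 + tt q 3 2, tt q 1 0 + tt q 2 3, tt q 1 1 - tt q 2 2,
   tt q 0 0 * tt q 1 1 - (q : ℂ) • (tt q 0 1 * tt q 1 0) - 1}

/-- The right ideal `ℛ = R · A(U_q(4))`, as a `ℂ`-submodule. -/
def RIdeal : Submodule ℂ (AU q) :=
  Submodule.span ℂ {y | ∃ x ∈ Rset q, ∃ a : AU q, y = x * a}

/-- The coalgebra `C = A(U_q(4)) / ℛ`. -/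
abbrev Cq : Type := AU q ⧸ RIdeal q

/-- The canonical projection `r : A(U_q(4)) → C`. -/
def rr : AU q →ₗ[ℂ] Cq q := (RIdeal q).mkQ

lemma RIdeal_mul_right {y : AU q} (hy : y ∈ RIdeal q) (c : AU q) : y * c ∈ RIdeal q := by
  induction hy using Submodule.span_induction with
  | mem x hx =>
      obtain ⟨x0, hx0, a, rfl⟩ := hx
      exact Submodule.subset_span ⟨x0, hx0, a * c, by rw [mul_assoc]⟩
  | zero => simp
  | add u v _ _ hu hv => simpa [add_mul] using (RIdeal q).add_mem hu hv
  | smul a u _ hu => simpa [smul_mul_assoc] using (RIdeal q).smul_mem a hu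

/-- Auxiliary map for the right `A(U_q(4))`-module structure of `C`:
right multiplication by `c` descends to the quotient. -/
def cactAux (c : AU q) : Cq q →ₗ[ℂ] Cq q :=
  Submodule.liftQ (RIdeal q) ((RIdeal q).mkQ ∘ₗ LinearMap.mulRight ℂ c)
    (by
      intro y hy
      simp only [LinearMap.mem_ker, LinearMap.comp_apply, LinearMap.mulRight_apply,
        Submodule.mkQ_apply, Submodule.Quotient.mk_eq_zero]
      exact RIdeal_mul_right q hy c)

@[simp] lemma cactAux_mk (c a : AU q) :
    cactAux q c (Submodule.Quotient.mk a) = (Submodule.Quotient.mk (a * c) : Cq q) := by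
  simp [cactAux]

/-- The right `A(U_q(4))`-module structure `r(t) · t' := r(t t')` of `C`,
as a bilinear map `A(U_q(4)) →ₗ C →ₗ C`, `(c, x) ↦ x · c`. -/
def cact : AU q →ₗ[ℂ] Cq q →ₗ[ℂ] Cq q where
  toFun c := cactAux q c
  map_add' c c' := by
    refine LinearMap.ext fun x => ?_
    obtain ⟨a, rfl⟩ := Submodule.Quotient.mk_surjective _ x
    simp only [cactAux_mk, mul_add, Submodule.Quotient.mk_add, LinearMap.add_apply]
  map_smul' s c := by
    refine LinearMap.ext fun x => ?_
    obtain ⟨a, rfl⟩ := Submodule.Quotient.mk_surjective _ x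
    simp only [cactAux_mk, mul_smul_comm, Submodule.Quotient.mk_smul, RingHom.id_apply, LinearMap.smul_apply]

@[simp] lemma cact_mk (c a : AU q) : cact q c (rr q a) = rr q (a * c) := by
  simp [cact, rr]

/-- θ(k) = 1 for k ≥ 0 and 0 for k < 0. -/
def thetaZ (k : ℤ) : ℂ := if 0 ≤ k then 1 else 0

/-- The linear basis elements `r^{k,m,n}` of `C`, given as representatives in `A(U_q(4))`. -/
def bas (k : ℤ) (m n : ℕ) : AU q :=
  if 0 ≤ k then tt q 0 0 ^ k.toNat * tt q 0 1 ^ m * tt q 1 0 ^ n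
  else tt q 0 1 ^ m * tt q 1 0 ^ n * tt q 1 1 ^ (-k).toNat

/-! ### The quantum seven-sphere -/

/-- Generators of `A(S⁷_q)`: `(i, false)` is `z_i`, `(i, true)` is `z_i^*`. -/
abbrev genS : Type := Fin 4 × Bool

abbrev FS : Type := FreeAlgebra ℂ genS

def Z0 (i : Fin 4) : FS := FreeAlgebra.ι ℂ (i, false)

def Zs0 (i : Fin 4) : FS := FreeAlgebra.ι ℂ (i, true)

/-- The defining relations of the ∗-algebra `A(S⁷_q)` (including the ∗-conjugate of the
first family of relations, so that the relation set is closed under the involution). -/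
inductive relS (q : ℝ) : FS → FS → Prop
  | zz {i j : Fin 4} : i < j → relS q (Z0 i * Z0 j) ((q : ℂ) • (Z0 j * Z0 i))
  | ss {i j : Fin 4} : i < j → relS q (Zs0 j * Zs0 i) ((q : ℂ) • (Zs0 i * Zs0 j))
  | sz {i j : Fin 4} : i ≠ j → relS q (Zs0 j * Z0 i) ((q : ℂ) • (Z0 i * Zs0 j))
  | szz {k : Fin 4} : relS q (Zs0 k * Z0 k)
      (Z0 k * Zs0 k + (1 - (q : ℂ) ^ 2) •
        ∑ j ∈ Finset.univ.filter (· < k), Z0 j * Zs0 j)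
  | sum1 : relS q (∑ k : Fin 4, Z0 k * Zs0 k) 1

/-- The algebra `P = A(S⁷_q)`. -/
abbrev PA : Type := RingQuot (relS q)

/-- The generators `z_i` of `A(S⁷_q)` (0-based index). -/
def z (i : Fin 4) : PA q := RingQuot.mkAlgHom ℂ (relS q) (Z0 i)

/-- The generators `z_i^*` of `A(S⁷_q)` (0-based index). -/
def zs (i : Fin 4) : PA q := RingQuot.mkAlgHom ℂ (relS q) (Zs0 i)

/-- The element `R = z₁ z₁^* + z₂ z₂^*` of `A(S⁷_q)`. -/
def RRe [StarRing (PA q)] : PA q := z q 0 * star (z q 0) + z q 1 * star (z q 1)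

/-- The element `a = z₁ z₄^* − z₂ z₃^*` of `A(S⁷_q)`. -/
def aa [StarRing (PA q)] : PA q := z q 0 * star (z q 3) - z q 1 * star (z q 2)

/-- The element `b = z₁ z₃ + q⁻¹ z₂ z₄` of `A(S⁷_q)`. -/
def bb : PA q := z q 0 * z q 2 + (q : ℂ)⁻¹ • (z q 1 * z q 3)

/-- The elements `a_n = z₁ z₄^* − qⁿ z₂ z₃^*` of `A(S⁷_q)`. -/
def aN [StarRing (PA q)] (n : ℤ) : PA q :=
  z q 0 * star (z q 3) - ((q : ℂ) ^ n) • (z q 1 * star (z q 2))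

/-- The elements `b_n = z₁ z₃ + q^{n−1} z₂ z₄` of `A(S⁷_q)`. -/
def bN (n : ℤ) : PA q := z q 0 * z q 2 + ((q : ℂ) ^ (n - 1)) • (z q 1 * z q 3)

/-! ### The coaction, the coinvariants and the canonical map -/

variable (δ : PA q →ₐ[ℂ] PA q ⊗[ℂ] AU q)

/-- `Δ_r := (id ⊗ r) ∘ Δ : A(S⁷_q) → A(S⁷_q) ⊗ C`, built from the
`A(U_q(4))`-coaction `δ`. -/
def Dr : PA q →ₗ[ℂ] PA q ⊗[ℂ] Cq q :=
  (LinearMap.lTensor (PA q) (rr q)) ∘ₗ δ.toLinearMap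

/-- The set of coinvariants `B = A(Σ⁴_q) = {a | Δ_r(a) = a ⊗ r(1)}`. -/
def Bset : Set (PA q) := {a : PA q | Dr q δ a = a ⊗ₜ[ℂ] rr q 1}

/-- The subspace of `P ⊗ P` spanned by the elements `(u b) ⊗ v − u ⊗ (b v)` with `b`
a coinvariant; quotienting by it produces the balanced tensor product `P ⊗_B P`. -/
def relT : Submodule ℂ (PA q ⊗[ℂ] PA q) :=
  Submodule.span ℂ
    {x : PA q ⊗[ℂ] PA q | ∃ u v b : PA q, b ∈ Bset q δ ∧
      x = (u * b) ⊗ₜ[ℂ] v - u ⊗ₜ[ℂ] (b * v)}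

instance instAddCommGroupPAPA : AddCommGroup (PA q ⊗[ℂ] PA q) := TensorProduct.addCommGroup

/-- The balanced tensor product `P ⊗_B P` over the coinvariant subalgebra `B = A(Σ⁴_q)`. -/
abbrev PBP : Type := (PA q ⊗[ℂ] PA q) ⧸ relT q δ

/-- The canonical projection `P ⊗ P → P ⊗_B P`. -/
def mkT : PA q ⊗[ℂ] PA q →ₗ[ℂ] PBP q δ := (relT q δ).mkQ

lemma relT_map_lmul (p : PA q) {x : PA q ⊗[ℂ] PA q} (hx : x ∈ relT q δ) :
    TensorProduct.map (LinearMap.mulLeft ℂ p) LinearMap.id x ∈ relT q δ := by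
  induction hx using Submodule.span_induction with
  | mem y hy =>
      obtain ⟨u, v, b, hb, rfl⟩ := hy
      refine Submodule.subset_span ⟨p * u, v, b, hb, ?_⟩
      simp [TensorProduct.map_tmul, mul_assoc]
  | zero => simp
  | add u v _ _ hu hv => simpa [map_add] using Submodule.add_mem _ hu hv
  | smul a u _ hu => simpa [map_smul] using Submodule.smul_mem _ a hu

lemma relT_map_rmul (p : PA q) {x : PA q ⊗[ℂ] PA q} (hx : x ∈ relT q δ) :
    TensorProduct.map LinearMap.id (LinearMap.mulRight ℂ p) x ∈ relT q δ := by
  induction hx using Submodule.span_induction with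
  | mem y hy =>
      obtain ⟨u, v, b, hb, rfl⟩ := hy
      refine Submodule.subset_span ⟨u, v * p, b, hb, ?_⟩
      simp [TensorProduct.map_tmul, mul_assoc]
  | zero => simp
  | add u v _ _ hu hv => simpa [map_add] using Submodule.add_mem _ hu hv
  | smul a u _ hu => simpa [map_smul] using Submodule.smul_mem _ a hu

/-- Left multiplication by `p ∈ P` on the bimodule `P ⊗_B P`. -/
def lact (p : PA q) : PBP q δ →ₗ[ℂ] PBP q δ :=
  Submodule.liftQ (relT q δ)
    ((relT q δ).mkQ ∘ₗ TensorProduct.map (LinearMap.mulLeft ℂ p) LinearMap.id)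
    (by
      intro x hx
      simp only [LinearMap.mem_ker, LinearMap.comp_apply, Submodule.mkQ_apply,
        Submodule.Quotient.mk_eq_zero]
      exact relT_map_lmul q δ p hx)

/-- Right multiplication by `p ∈ P` on the bimodule `P ⊗_B P`. -/
def ract (p : PA q) : PBP q δ →ₗ[ℂ] PBP q δ :=
  Submodule.liftQ (relT q δ)
    ((relT q δ).mkQ ∘ₗ TensorProduct.map LinearMap.id (LinearMap.mulRight ℂ p))
    (by
      intro x hx
      simp only [LinearMap.mem_ker, LinearMap.comp_apply, Submodule.mkQ_apply,
        Submodule.Quotient.mk_eq_zero]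
      exact relT_map_rmul q δ p hx)

/-- The structure map of the right action `◁` of `A(S⁷_q)` on `A(S⁷_q) ⊗ C`:
on simple tensors, `(u ⊗ x) ⊗ (w ⊗ y) ↦ (u w) ⊗ (x · y)`.  The action is
`(u ⊗ x) ◁ v = triMap ((u ⊗ x) ⊗ δ v) = Σ u v₍₀₎ ⊗ x · v₍₁₎`. -/
def triMap : (PA q ⊗[ℂ] Cq q) ⊗[ℂ] (PA q ⊗[ℂ] AU q) →ₗ[ℂ] PA q ⊗[ℂ] Cq q :=
  (TensorProduct.map (LinearMap.mul' ℂ (PA q)) (TensorProduct.lift (LinearMap.flip (cact q)))) ∘ₗ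
    (TensorProduct.tensorTensorTensorComm ℂ (PA q) (Cq q) (PA q) (AU q)).toLinearMap

section BlockLemmas

/-- In a `2 × 2` quantum matrix algebra the quantum determinant is central; abstract version. -/
lemma qdet_comm_abs {A : Type*} [Ring A] [Algebra ℂ A] (p : ℂ) (hp : p ≠ 0) (a b c d : A)
    (hab : a * b = p • (b * a)) (hac : a * c = p • (c * a)) (hbd : b * d = p • (d * b))
    (hcd : c * d = p • (d * c)) (hbc : b * c = c * b)
    (had : a * d - d * a = (p - p⁻¹) • (c * b)) :
    Commute (a * d - p • (b * c)) a ∧ Commute (a * d - p • (b * c)) b ∧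
    Commute (a * d - p • (b * c)) c ∧ Commute (a * d - p • (b * c)) d := by
  have r1 : b * a = p⁻¹ • (a * b) := by rw [hab, smul_smul, inv_mul_cancel₀ hp, one_smul]
  have r2 : c * a = p⁻¹ • (a * c) := by rw [hac, smul_smul, inv_mul_cancel₀ hp, one_smul]
  have r3 : d * b = p⁻¹ • (b * d) := by rw [hbd, smul_smul, inv_mul_cancel₀ hp, one_smul]
  have r4 : d * c = p⁻¹ • (c * d) := by rw [hcd, smul_smul, inv_mul_cancel₀ hp, one_smul]
  have r5 : c * b = b * c := hbc.symm
  have r6 : d * a = a * d - (p - p⁻¹) • (b * c) := by rw [hbc, ← had]; abel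
  have s1 : ∀ x, b * (a * x) = p⁻¹ • (a * (b * x)) := fun x => by
    rw [← mul_assoc, r1, smul_mul_assoc, mul_assoc]
  have s2 : ∀ x, c * (a * x) = p⁻¹ • (a * (c * x)) := fun x => by
    rw [← mul_assoc, r2, smul_mul_assoc, mul_assoc]
  have s3 : ∀ x, d * (b * x) = p⁻¹ • (b * (d * x)) := fun x => by
    rw [← mul_assoc, r3, smul_mul_assoc, mul_assoc]
  have s4 : ∀ x, d * (c * x) = p⁻¹ • (c * (d * x)) := fun x => by
    rw [← mul_assoc, r4, smul_mul_assoc, mul_assoc]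
  have s5 : ∀ x, c * (b * x) = b * (c * x) := fun x => by
    rw [← mul_assoc, r5, mul_assoc]
  have s6 : ∀ x, d * (a * x) = a * (d * x) - (p - p⁻¹) • (b * (c * x)) := fun x => by
    rw [← mul_assoc, r6, sub_mul, smul_mul_assoc, mul_assoc, mul_assoc]
  refine ⟨?_, ?_, ?_, ?_⟩ <;>
  · simp only [Commute, SemiconjBy, sub_mul, mul_sub, smul_mul_assoc, mul_smul_comm, mul_assoc,
      r1, r2, r3, r4, r5, r6, s1, s2, s3, s4, s5, s6, smul_smul, smul_sub]
    try (match_scalars <;> field_simp <;> try ring)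

lemma qdet_alt_abs {A : Type*} [Ring A] [Algebra ℂ A] (p : ℂ) (a b c d : A)
    (hbc : b * c = c * b) (had : a * d - d * a = (p - p⁻¹) • (c * b)) :
    a * d - p • (b * c) = d * a - p⁻¹ • (b * c) := by
  rw [sub_eq_iff_eq_add.1 had, hbc]
  module

lemma tt_col {i j k : Fin 4} (h : i < j) :
    tt q i k * tt q j k = (q : ℂ) • (tt q j k * tt q i k) := by
  simpa only [tt, map_mul, map_smul] using
    RingQuot.mkAlgHom_rel ℂ (relU.col (q := q) (k := k) h)

lemma tt_row {i j k : Fin 4} (h : i < j) :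
    tt q k i * tt q k j = (q : ℂ) • (tt q k j * tt q k i) := by
  simpa only [tt, map_mul, map_smul] using
    RingQuot.mkAlgHom_rel ℂ (relU.row (q := q) (k := k) h)

lemma tt_comm {i j k l : Fin 4} (h : i < j) (h' : k < l) :
    tt q i l * tt q j k = tt q j k * tt q i l := by
  simpa only [tt, map_mul, map_smul] using
    RingQuot.mkAlgHom_rel ℂ (relU.comm (q := q) h h')

lemma tt_qcom {i j k l : Fin 4} (h : i < j) (h' : k < l) :
    tt q i k * tt q j l - tt q j l * tt q i k =
      ((q : ℂ) - (q : ℂ)⁻¹) • (tt q j k * tt q i l) := by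
  simpa only [tt, map_mul, map_smul, map_sub] using
    RingQuot.mkAlgHom_rel ℂ (relU.qcom (q := q) h h')

/-- The subalgebra generated by the upper left block. -/
def Blk : Subalgebra ℂ (AU q) :=
  Algebra.adjoin ℂ {x | ∃ i j : Fin 4, i < 2 ∧ j < 2 ∧ x = tt q i j}

lemma tt_mem_Blk {i j : Fin 4} (hi : i < 2) (hj : j < 2) : tt q i j ∈ Blk q :=
  Algebra.subset_adjoin ⟨i, j, hi, hj, rfl⟩

/-- The right ideal generated by the upper right block. -/
def JId : Submodule ℂ (AU q) :=
  Submodule.span ℂ {y | ∃ i j : Fin 4, i < 2 ∧ 2 ≤ j ∧ ∃ a : AU q, y = tt q i j * a}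

lemma JId_gen {i j : Fin 4} (hi : i < 2) (hj : 2 ≤ j) (a : AU q) : tt q i j * a ∈ JId q :=
  Submodule.subset_span ⟨i, j, hi, hj, a, rfl⟩

lemma JId_le : JId q ≤ RIdeal q := by
  refine Submodule.span_le.2 ?_
  rintro _ ⟨i, j, hi, hj, a, rfl⟩
  refine Submodule.subset_span ⟨tt q i j, ?_, a, rfl⟩
  fin_cases i <;> fin_cases j <;> simp_all [Rset, Fin.lt_def, Fin.le_def]

lemma JId_gen_left {a b k l : Fin 4} (ha : a < 2) (hb : b < 2) (hk : k < 2) (hl : 2 ≤ l)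
    (x : AU q) : tt q a b * (tt q k l * x) ∈ JId q := by
  have hbl : b < l := lt_of_lt_of_le hb hl
  rw [← mul_assoc]
  rcases lt_trichotomy a k with h | h | h
  · have e : tt q a b * tt q k l =
        tt q k l * tt q a b + ((q : ℂ) - (q : ℂ)⁻¹) • (tt q a l * tt q k b) := by
      rw [tt_comm q h hbl, ← tt_qcom q h hbl]; abel
    rw [e, add_mul, smul_mul_assoc, mul_assoc, mul_assoc]
    exact (JId q).add_mem (JId_gen q hk hl _) ((JId q).smul_mem _ (JId_gen q ha hl _))
  · subst h
    rw [tt_row q hbl, smul_mul_assoc, mul_assoc]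
    exact (JId q).smul_mem _ (JId_gen q hk hl _)
  · rw [← tt_comm q h hbl, mul_assoc]
    exact JId_gen q hk hl _

lemma JId_left {b : AU q} (hb : b ∈ Blk q) : ∀ x ∈ JId q, b * x ∈ JId q := by
  induction hb using Algebra.adjoin_induction with
  | mem b hb =>
      obtain ⟨i, j, hi, hj, rfl⟩ := hb
      intro x hx
      induction hx using Submodule.span_induction with
      | mem y hy =>
          obtain ⟨k, l, hk, hl, a, rfl⟩ := hy
          exact JId_gen_left q hi hj hk hl a
      | zero => simp
      | add u v _ _ hu hv => simpa [mul_add] using (JId q).add_mem hu hv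
      | smul c u _ hu => simpa [mul_smul_comm] using (JId q).smul_mem c hu
  | algebraMap c =>
      intro x hx
      rw [← Algebra.smul_def]
      exact (JId q).smul_mem c hx
  | add u v _ _ hu hv =>
      intro x hx
      rw [add_mul]
      exact (JId q).add_mem (hu x hx) (hv x hx)
  | mul u v _ _ hu hv =>
      intro x hx
      rw [mul_assoc]
      exact hu _ (hv x hx)

lemma rr_zero {b : AU q} (hb : b ∈ Blk q) {i j : Fin 4} (hi : i < 2) (hj : 2 ≤ j) (x : AU q) :
    rr q (b * (tt q i j * x)) = 0 := by
  rw [rr, Submodule.mkQ_apply, Submodule.Quotient.mk_eq_zero]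
  exact JId_le q (JId_left q hb _ (JId_gen q hi hj x))

/-- The quantum determinant of the upper left block. -/
def qd : AU q := tt q 0 0 * tt q 1 1 - (q : ℂ) • (tt q 0 1 * tt q 1 0)

lemma qd_comm (hq : (q : ℂ) ≠ 0) {b : AU q} (hb : b ∈ Blk q) : Commute (qd q) b := by
  have h01 : (0 : Fin 4) < 1 := by decide
  obtain ⟨h1, h2, h3, h4⟩ := qdet_comm_abs (q : ℂ) hq (tt q 0 0) (tt q 0 1) (tt q 1 0) (tt q 1 1)
    (tt_row q h01) (tt_col q h01) (tt_col q h01) (tt_row q h01) (tt_comm q h01 h01)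
    (tt_qcom q h01 h01)
  induction hb using Algebra.adjoin_induction with
  | mem b hb =>
      obtain ⟨i, j, hi, hj, rfl⟩ := hb
      have hi' : i = 0 ∨ i = 1 := by revert i; decide
      have hj' : j = 0 ∨ j = 1 := by revert j; decide
      rcases hi' with rfl | rfl <;> rcases hj' with rfl | rfl
      exacts [h1, h2, h3, h4]
  | algebraMap c => exact (Algebra.commutes c (qd q)).symm
  | add u v _ _ hu hv => exact hu.add_right hv
  | mul u v _ _ hu hv => exact hu.mul_right hv

lemma rr_qd (hq : (q : ℂ) ≠ 0) {b : AU q} (hb : b ∈ Blk q) (x : AU q) :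
    rr q (b * (qd q * x)) = rr q (b * x) := by
  have e : b * (qd q * x) - b * x = (qd q - 1) * (b * x) := by
    rw [← mul_assoc, ← (qd_comm q hq hb).eq, sub_mul, one_mul, mul_assoc]
  rw [← sub_eq_zero, ← map_sub, e, rr, Submodule.mkQ_apply, Submodule.Quotient.mk_eq_zero]
  exact Submodule.subset_span ⟨_, by simp [Rset, qd], _, rfl⟩

lemma bas_mem (k : ℤ) (m n : ℕ) : bas q k m n ∈ Blk q := by
  have h0 : (0 : Fin 4) < 2 := by decide
  have h1 : (1 : Fin 4) < 2 := by decide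
  unfold bas
  split_ifs
  · exact mul_mem (mul_mem (pow_mem (tt_mem_Blk q h0 h0) _) (pow_mem (tt_mem_Blk q h0 h1) _))
      (pow_mem (tt_mem_Blk q h1 h0) _)
  · exact mul_mem (mul_mem (pow_mem (tt_mem_Blk q h0 h1) _) (pow_mem (tt_mem_Blk q h1 h0) _))
      (pow_mem (tt_mem_Blk q h1 h1) _)

lemma rr_block (S : AU q →ₗ[ℂ] AU q)
    (hSright : ∀ i j : Fin 4, ∑ k : Fin 4, tt q i k * S (tt q k j) = if i = j then 1 else 0)
    {u : AU q} (hu : u ∈ Blk q) {i : Fin 4} (hi : i < 2) (j : Fin 4) :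
    rr q (u * (tt q i 0 * S (tt q 0 j))) + rr q (u * (tt q i 1 * S (tt q 1 j))) =
      if i = j then rr q u else 0 := by
  have h := congrArg (fun x => rr q (u * x)) (hSright i j)
  simp only [Fin.sum_univ_four, mul_add, map_add] at h
  rw [rr_zero q hu hi (j := 2) (by decide), rr_zero q hu hi (j := 3) (by decide),
    add_zero, add_zero] at h
  rw [h]
  split_ifs <;> simp

lemma rr_S0 (hq : (q : ℂ) ≠ 0) (S : AU q →ₗ[ℂ] AU q)
    (hSright : ∀ i j : Fin 4, ∑ k : Fin 4, tt q i k * S (tt q k j) = if i = j then 1 else 0)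
    {w : AU q} (hw : w ∈ Blk q) (j : Fin 4) :
    rr q (w * S (tt q 0 j)) = (if 0 = j then rr q (w * tt q 1 1) else 0)
      - (q : ℂ)⁻¹ • (if 1 = j then rr q (w * tt q 0 1) else 0) := by
  have h01 : (0 : Fin 4) < 1 := by decide
  have h0 : (0 : Fin 4) < 2 := by decide
  have h1 : (1 : Fin 4) < 2 := by decide
  rw [← rr_block q S hSright (mul_mem hw (tt_mem_Blk q h1 h1)) h0 j,
    ← rr_block q S hSright (mul_mem hw (tt_mem_Blk q h0 h1)) h1 j, ← rr_qd q hq hw]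
  have e1 : qd q = tt q 1 1 * tt q 0 0 - (q : ℂ)⁻¹ • (tt q 0 1 * tt q 1 0) :=
    qdet_alt_abs (q : ℂ) _ _ _ _ (tt_comm q h01 h01) (tt_qcom q h01 h01)
  have e2 : tt q 1 1 * tt q 0 1 = (q : ℂ)⁻¹ • (tt q 0 1 * tt q 1 1) := by
    rw [tt_col q h01, smul_smul, inv_mul_cancel₀ hq, one_smul]
  have e3 : w * tt q 1 1 * (tt q 0 1 * S (tt q 1 j)) =
      (q : ℂ)⁻¹ • (w * tt q 0 1 * (tt q 1 1 * S (tt q 1 j))) := by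
    rw [← mul_assoc, mul_assoc w, e2, mul_smul_comm, smul_mul_assoc]; simp only [mul_assoc]
  rw [e3, e1]
  simp only [sub_mul, mul_sub, map_sub, map_smul, smul_mul_assoc, mul_smul_comm, mul_assoc]
  module

lemma rr_S1 (hq : (q : ℂ) ≠ 0) (S : AU q →ₗ[ℂ] AU q)
    (hSright : ∀ i j : Fin 4, ∑ k : Fin 4, tt q i k * S (tt q k j) = if i = j then 1 else 0)
    {w : AU q} (hw : w ∈ Blk q) (j : Fin 4) :
    rr q (w * S (tt q 1 j)) = (if 1 = j then rr q (w * tt q 0 0) else 0)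
      - (q : ℂ) • (if 0 = j then rr q (w * tt q 1 0) else 0) := by
  have h01 : (0 : Fin 4) < 1 := by decide
  have h0 : (0 : Fin 4) < 2 := by decide
  have h1 : (1 : Fin 4) < 2 := by decide
  rw [← rr_block q S hSright (mul_mem hw (tt_mem_Blk q h0 h0)) h1 j,
    ← rr_block q S hSright (mul_mem hw (tt_mem_Blk q h1 h0)) h0 j, ← rr_qd q hq hw]
  have e1 : qd q = tt q 0 0 * tt q 1 1 - (q : ℂ) • (tt q 1 0 * tt q 0 1) := by
    rw [qd, tt_comm q h01 h01]
  have e3 : w * tt q 0 0 * (tt q 1 0 * S (tt q 0 j)) =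
      (q : ℂ) • (w * tt q 1 0 * (tt q 0 0 * S (tt q 0 j))) := by
    rw [← mul_assoc, mul_assoc w, tt_col q h01, mul_smul_comm, smul_mul_assoc]
    simp only [mul_assoc]
  rw [e3, e1]
  simp only [sub_mul, mul_sub, map_sub, map_smul, smul_mul_assoc, mul_smul_comm, mul_assoc]
  module

end BlockLemmas

theorem module_relations_star_block11 (q : ℝ) (hq0 : 0 < q) (hq1 : q < 1)
    [StarRing (AU q)] [StarModule ℂ (AU q)]
    (S : AU q →ₗ[ℂ] AU q)
    (hSanti : ∀ x y : AU q, S (x * y) = S y * S x) (hS1 : S 1 = 1)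
    (hSleft : ∀ i j : Fin 4, ∑ k : Fin 4, S (tt q i k) * tt q k j = if i = j then 1 else 0)
    (hSright : ∀ i j : Fin 4, ∑ k : Fin 4, tt q i k * S (tt q k j) = if i = j then 1 else 0)
    (hSD : S (Dq q) = dI q) (hSDi : S (dI q) = Dq q)
    (hstarT : ∀ i j : Fin 4, star (tt q i j) = S (tt q j i))
    (hstarD : star (Dq q) = dI q)
    (k : ℤ) (m n : ℕ)
        : rr q (bas q k m n * star (tt q 0 0)) = rr q (bas q k m n * tt q 1 1) ∧
    rr q (bas q k m n * star (tt q 0 1)) = -((q : ℂ) • rr q (bas q k m n * tt q 1 0)) ∧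
    rr q (bas q k m n * star (tt q 1 0)) = -((q : ℂ)⁻¹ • rr q (bas q k m n * tt q 0 1)) ∧
    rr q (bas q k m n * star (tt q 1 1)) = rr q (bas q k m n * tt q 0 0) := by
  have hq : (q : ℂ) ≠ 0 := by exact_mod_cast hq0.ne'
  have hw := bas_mem q k m n
  rw [hstarT, hstarT, hstarT, hstarT, rr_S0 q hq S hSright hw, rr_S0 q hq S hSright hw,
    rr_S1 q hq S hSright hw, rr_S1 q hq S hSright hw]
  refine ⟨?_, ?_, ?_, ?_⟩ <;> simp

end QIB
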